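/- Let A be a hermitian-closed unital subalgebra of M_d(ℂ). Then the Mutual Averaged Non-commutativity of A with the full matrix algebra satisfies S(A : M_d(ℂ)) = 1 − dim_ℂ(A')/d², where A' is the commutant of A. -/

import Mathlib

open MeasureTheory Matrix Kronecker

noncomputable section

instance matMeasurableSpace (n : Type*) [Fintype n] : MeasurableSpace (Matrix n n ℂ) :=
  show MeasurableSpace (n → n → ℂ) from inferInstance

/-- Squared Frobenius (Hilbert-Schmidt) norm `‖X‖₂² = Tr(X† X)`. -/
def hs2 {n : Type*} [Fintype n] (X : Matrix n n ℂ) : ℝ := (Matrix.trace (Xᴴ * X)).re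

/-- Mutual Averaged Non-commutativity: `(1/(2d)) ∫∫ ‖UV - VU‖₂² dμ(U) dν(V)`,
where `μ`, `ν` are meant to be the normalized Haar measures of the unitary groups of
the two algebras (imposed by the `IsHaar` hypotheses in the theorems below). -/
def MAN {n : Type*} [Fintype n] (μ ν : Measure (Matrix n n ℂ)) : ℝ :=
  (1 / (2 * (Fintype.card n : ℝ))) * ∫ U, ∫ V, hs2 (U * V - V * U) ∂ν ∂μ

/-- `μ` is the normalized Haar probability measure of the compact unitary group
`U(A) = {U ∈ A : U†U = UU† = 1}` of the star-subalgebra `A`, viewed as a measure on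
matrix space concentrated on `U(A)` and invariant under left translation by `U(A)`. -/
def IsHaar {n : Type*} [Fintype n] [DecidableEq n] (A : StarSubalgebra ℂ (Matrix n n ℂ))
    (μ : Measure (Matrix n n ℂ)) : Prop :=
  IsProbabilityMeasure μ ∧
  μ {U | ¬ (U ∈ A ∧ U ∈ unitary (Matrix n n ℂ))} = 0 ∧
  ∀ U ∈ A, U ∈ unitary (Matrix n n ℂ) → μ.map (fun V => U * V) = μ

/-- The commutant `A' = {X : XY = YX ∀ Y ∈ A}` as a ℂ-subspace of matrix space. -/
def commSub {n : Type*} [Fintype n] [DecidableEq n] (A : StarSubalgebra ℂ (Matrix n n ℂ)) :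
    Submodule ℂ (Matrix n n ℂ) where
  carrier := {X | ∀ Y ∈ A, X * Y = Y * X}
  add_mem' := by
    intro a b ha hb Y hY
    rw [add_mul, mul_add, ha Y hY, hb Y hY]
  zero_mem' := by
    intro Y hY
    rw [zero_mul, mul_zero]
  smul_mem' := by
    intro c X hX Y hY
    rw [smul_mul_assoc, hX Y hY, mul_smul_comm]

/-- The twirl `X ↦ ∫ U X U† dμ(U)`, written entrywise so that it is linear for every measure `μ`. -/
def twirl {n : Type*} [Fintype n] (μ : Measure (Matrix n n ℂ)) :
    Matrix n n ℂ →ₗ[ℂ] Matrix n n ℂ where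
  toFun X := of fun i j => ∑ k, ∑ l, X k l * ∫ U, U i k * star (U j l) ∂μ
  map_add' X Y := by
    ext i j
    simp [add_mul, Finset.sum_add_distrib]
  map_smul' c X := by
    ext i j
    simp [Finset.mul_sum, mul_assoc]

section

variable {n : Type*} [Fintype n]

theorem measurable_matrix_entry (i j : n) : Measurable fun U : Matrix n n ℂ => U i j :=
  (measurable_pi_apply j).comp (measurable_pi_apply (X := fun _ : n => n → ℂ) i)

theorem measurable_matrix_mul_left (W : Matrix n n ℂ) :
    Measurable fun U : Matrix n n ℂ => W * U := by
  refine measurable_pi_iff.2 fun i => measurable_pi_iff.2 fun j => ?_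
  simp only [mul_apply]
  exact Finset.measurable_fun_sum _ fun k _ => (measurable_matrix_entry k j).const_mul _

theorem mul_mul_conjTranspose_apply (U X : Matrix n n ℂ) (i j : n) :
    (U * X * Uᴴ) i j = ∑ k, ∑ l, X k l * (U i k * star (U j l)) := by
  simp only [mul_apply, conjTranspose_apply, Finset.sum_mul]
  rw [Finset.sum_comm]
  exact Finset.sum_congr rfl fun k _ => Finset.sum_congr rfl fun l _ => by ring

theorem trace_mul_star_trace (U : Matrix n n ℂ) :
    U.trace * star U.trace = ∑ i, ∑ j, U i i * star (U j j) := by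
  simp only [trace, diag_apply, star_sum, Finset.sum_mul_sum]

variable [DecidableEq n] {A : StarSubalgebra ℂ (Matrix n n ℂ)} {μ : Measure (Matrix n n ℂ)}

theorem IsHaar.ae_mem (h : IsHaar A μ) : ∀ᵐ U ∂μ, U ∈ A ∧ U ∈ unitary (Matrix n n ℂ) :=
  ae_iff.2 h.2.1

theorem IsHaar.integrable_entry_mul_star (h : IsHaar A μ) (i k j l : n) :
    Integrable (fun U => U i k * star (U j l)) μ := by
  have := h.1
  refine Integrable.of_bound (C := 1)
    ((measurable_matrix_entry i k).mul
      (continuous_star.measurable.comp (measurable_matrix_entry j l))).aestronglyMeasurable ?_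
  filter_upwards [h.ae_mem] with U hU
  rw [norm_mul, norm_star]
  exact mul_le_one₀ (entry_norm_bound_of_unitary hU.2 i k) (norm_nonneg _)
    (entry_norm_bound_of_unitary hU.2 j l)

theorem IsHaar.integrable_conj_apply (h : IsHaar A μ) (X : Matrix n n ℂ) (i j : n) :
    Integrable (fun U => (U * X * Uᴴ) i j) μ := by
  simp only [mul_mul_conjTranspose_apply]
  exact integrable_finsetSum _ fun k _ => integrable_finsetSum _ fun l _ =>
    (h.integrable_entry_mul_star i k j l).const_mul _

theorem IsHaar.twirl_apply (h : IsHaar A μ) (X : Matrix n n ℂ) (i j : n) :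
    twirl μ X i j = ∫ U, (U * X * Uᴴ) i j ∂μ := by
  have hdef : twirl μ X i j = ∑ k, ∑ l, X k l * ∫ U, U i k * star (U j l) ∂μ := rfl
  have hint (k l : n) : Integrable (fun U => X k l * (U i k * star (U j l))) μ :=
    (h.integrable_entry_mul_star i k j l).const_mul _
  simp only [hdef, mul_mul_conjTranspose_apply]
  rw [integral_finsetSum _ fun k _ => integrable_finsetSum _ fun l _ => hint k l]
  refine Finset.sum_congr rfl fun k _ => ?_
  rw [integral_finsetSum _ fun l _ => hint k l]
  exact Finset.sum_congr rfl fun l _ => (integral_const_mul _ _).symm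

theorem exists_linearMap_apply_eq_sum (φ : Matrix n n ℂ →ₗ[ℂ] ℂ) :
    ∃ c : n → n → ℂ, ∀ M, φ M = ∑ i, ∑ j, M i j * c i j := by
  refine ⟨fun i j => φ (single i j 1), fun M => ?_⟩
  conv_lhs => rw [matrix_eq_sum_single M]
  simp only [map_sum]
  refine Finset.sum_congr rfl fun i _ => Finset.sum_congr rfl fun j _ => ?_
  rw [← smul_eq_mul, ← map_smul, smul_single, smul_eq_mul, mul_one]

theorem IsHaar.map_twirl (h : IsHaar A μ) (φ : Matrix n n ℂ →ₗ[ℂ] ℂ) (X : Matrix n n ℂ) :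
    φ (twirl μ X) = ∫ U, φ (U * X * Uᴴ) ∂μ := by
  obtain ⟨c, hc⟩ := exists_linearMap_apply_eq_sum φ
  simp only [hc, h.twirl_apply]
  rw [integral_finsetSum _ fun k _ => integrable_finsetSum _ fun l _ =>
    (h.integrable_conj_apply X k l).mul_const _]
  refine Finset.sum_congr rfl fun k _ => ?_
  rw [integral_finsetSum _ fun l _ => (h.integrable_conj_apply X k l).mul_const _]
  exact Finset.sum_congr rfl fun l _ => (integral_mul_const _ _).symm

open scoped Matrix.Norms.L2Operator in
theorem mem_commSub_of_forall_unitary {X : Matrix n n ℂ}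
    (h : ∀ W ∈ A, W ∈ unitary (Matrix n n ℂ) → X * W = W * X) : X ∈ commSub A := by
  have : IsClosed (A : Set (Matrix n n ℂ)) :=
    Submodule.closed_of_finiteDimensional (Subalgebra.toSubmodule A.toSubalgebra)
  intro Y hY
  have hspan : (⟨Y, hY⟩ : A) ∈ Submodule.span ℂ (unitary A : Set A) := by
    rw [CStarAlgebra.span_unitary]; trivial
  refine Submodule.span_induction (p := fun (Z : A) _ => X * (Z : Matrix n n ℂ) = Z * X)
    ?_ ?_ ?_ ?_ hspan
  · intro W hW
    refine h W W.2 ?_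
    rw [Unitary.mem_iff] at *
    exact ⟨congrArg Subtype.val hW.1, congrArg Subtype.val hW.2⟩
  · simp
  · intro x y _ _ hx hy
    simp [mul_add, add_mul, hx, hy]
  · intro c x _ hx
    simp [hx]

theorem IsHaar.mul_twirl_mul_conjTranspose (h : IsHaar A μ) (X : Matrix n n ℂ)
    {W : Matrix n n ℂ} (hW : W ∈ A) (hWu : W ∈ unitary (Matrix n n ℂ)) :
    W * twirl μ X * Wᴴ = twirl μ X := by
  ext i j
  have hmap := h.map_twirl
    (entryLinearMap ℂ ℂ i j ∘ₗ LinearMap.mulRight ℂ Wᴴ ∘ₗ LinearMap.mulLeft ℂ W) X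
  simp only [LinearMap.comp_apply, LinearMap.mulLeft_apply, LinearMap.mulRight_apply,
    entryLinearMap_apply] at hmap
  rw [hmap, h.twirl_apply]
  conv_rhs => rw [← h.2.2 W hW hWu]
  rw [integral_map (measurable_matrix_mul_left W).aemeasurable]
  · simp only [conjTranspose_mul, mul_assoc]
  · rw [h.2.2 W hW hWu]
    exact (h.integrable_conj_apply X i j).aestronglyMeasurable

theorem IsHaar.twirl_mem_commSub (h : IsHaar A μ) (X : Matrix n n ℂ) :
    twirl μ X ∈ commSub A := by
  refine mem_commSub_of_forall_unitary fun W hW hWu => ?_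
  conv_rhs => rw [← mul_one (W * _), ← (Unitary.mem_iff.1 hWu).1, ← mul_assoc]
  exact congrArg (· * W) (h.mul_twirl_mul_conjTranspose X hW hWu).symm

theorem IsHaar.twirl_eq_self (h : IsHaar A μ) {X : Matrix n n ℂ} (hX : X ∈ commSub A) :
    twirl μ X = X := by
  have := h.1
  ext i j
  rw [h.twirl_apply]
  trans ∫ _, X i j ∂μ
  · refine integral_congr_ae ?_
    filter_upwards [h.ae_mem] with U hU
    rw [← hX U hU.1, mul_assoc, ← star_eq_conjTranspose, (Unitary.mem_iff.1 hU.2).2, mul_one]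
  · simp

theorem IsHaar.trace_twirl_apply (h : IsHaar A μ) (X : Matrix n n ℂ) :
    (twirl μ X).trace = X.trace := by
  have := h.1
  refine (h.map_twirl (traceLinearMap n ℂ ℂ) X).trans ?_
  trans ∫ _, X.trace ∂μ
  · refine integral_congr_ae ?_
    filter_upwards [h.ae_mem] with U hU
    rw [traceLinearMap_apply, trace_mul_comm, ← mul_assoc, ← star_eq_conjTranspose,
      (Unitary.mem_iff.1 hU.2).1, one_mul]
  · simp

theorem IsHaar.trace_twirl (h : IsHaar A μ) :
    LinearMap.trace ℂ _ (twirl μ) = ∫ U, U.trace * star U.trace ∂μ := by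
  simp only [trace_mul_star_trace]
  rw [integral_finsetSum _ fun i _ => integrable_finsetSum _ fun j _ =>
      h.integrable_entry_mul_star i i j j,
    LinearMap.trace_eq_matrix_trace ℂ (stdBasis ℂ n n), trace, Fintype.sum_prod_type]
  refine Finset.sum_congr rfl fun i _ => ?_
  rw [integral_finsetSum _ fun j _ => h.integrable_entry_mul_star i i j j]
  refine Finset.sum_congr rfl fun j _ => ?_
  rw [diag_apply, LinearMap.toMatrix_apply, stdBasis_eq_single]
  simp [stdBasis, twirl, single_apply, ite_and]

theorem IsHaar.isProj_twirl (h : IsHaar A μ) : LinearMap.IsProj (commSub A) (twirl μ) :=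
  ⟨h.twirl_mem_commSub, fun _ hX => h.twirl_eq_self hX⟩

/-- The second moment of the character `U ↦ Tr U` is the dimension of the commutant. -/
theorem IsHaar.integral_trace_mul_star_trace (h : IsHaar A μ) :
    ∫ U, U.trace * star U.trace ∂μ = (Module.finrank ℂ (commSub A) : ℂ) := by
  rw [← h.trace_twirl, h.isProj_twirl.trace]

theorem IsHaar.twirl_top (h : IsHaar (⊤ : StarSubalgebra ℂ (Matrix n n ℂ)) μ)
    (X : Matrix n n ℂ) : (Fintype.card n : ℂ) • twirl μ X = X.trace • 1 := by
  obtain ⟨c, hc⟩ := mem_range_scalar_of_commute_single (M := twirl μ X) fun i j _ =>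
    (h.twirl_mem_commSub X (single i j 1) trivial).symm
  have htr := h.trace_twirl_apply X
  rw [← hc] at htr ⊢
  rw [← htr]
  ext i j
  simp [trace, diagonal_apply, one_apply]

theorem hs2_commutator {U V : Matrix n n ℂ} (hU : U ∈ unitary (Matrix n n ℂ))
    (hV : V ∈ unitary (Matrix n n ℂ)) :
    hs2 (U * V - V * U) = 2 * Fintype.card n - 2 * (Uᴴ * (V * U * Vᴴ)).trace.re := by
  obtain ⟨hU₁, -⟩ := Unitary.mem_iff.1 hU
  obtain ⟨hV₁, -⟩ := Unitary.mem_iff.1 hV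
  rw [star_eq_conjTranspose] at hU₁ hV₁
  have h₁ : Vᴴ * Uᴴ * (U * V) = 1 := by
    rw [mul_assoc, ← mul_assoc Uᴴ, hU₁, one_mul, hV₁]
  have h₂ : Uᴴ * Vᴴ * (V * U) = 1 := by
    rw [mul_assoc, ← mul_assoc Vᴴ, hV₁, one_mul, hU₁]
  have h₃ : (Vᴴ * Uᴴ * (V * U)).trace = (Uᴴ * (V * U * Vᴴ)).trace := by
    rw [mul_assoc, trace_mul_comm, mul_assoc]
  have h₄ : (Uᴴ * Vᴴ * (U * V)).trace = star (Vᴴ * Uᴴ * (V * U)).trace := by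
    rw [← trace_conjTranspose]
    simp only [conjTranspose_mul, conjTranspose_conjTranspose]
  simp only [hs2, conjTranspose_sub, conjTranspose_mul, sub_mul, mul_sub, trace_sub, h₁, h₂, h₄, h₃,
    trace_one, Complex.sub_re, Complex.natCast_re, Complex.star_def, Complex.conj_re]
  ring

theorem IsHaar.integrable_trace_mul_conj (h : IsHaar A μ) (X Y : Matrix n n ℂ) :
    Integrable (fun V => (Y * (V * X * Vᴴ)).trace) μ := by
  simp only [trace, diag_apply, Matrix.mul_apply (M := Y)]
  exact integrable_finsetSum _ fun i _ => integrable_finsetSum _ fun j _ =>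
    (h.integrable_conj_apply X j i).const_mul _

theorem IsHaar.integrable_trace_mul_star_trace (h : IsHaar A μ) :
    Integrable (fun U => U.trace * star U.trace) μ := by
  simp only [trace_mul_star_trace]
  exact integrable_finsetSum _ fun i _ => integrable_finsetSum _ fun j _ =>
    h.integrable_entry_mul_star i i j j

theorem IsHaar.integral_hs2_commutator [Nonempty n]
    (h : IsHaar (⊤ : StarSubalgebra ℂ (Matrix n n ℂ)) μ)
    {U : Matrix n n ℂ} (hU : U ∈ unitary (Matrix n n ℂ)) :
    ∫ V, hs2 (U * V - V * U) ∂μ =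
      2 * Fintype.card n - 2 / Fintype.card n * (U.trace * star U.trace).re := by
  have := h.1
  have hcard : (Fintype.card n : ℂ) ≠ 0 := Nat.cast_ne_zero.2 Fintype.card_ne_zero
  have hint := h.integrable_trace_mul_conj U Uᴴ
  have hint_re : Integrable (fun V => (Uᴴ * (V * U * Vᴴ)).trace.re) μ := hint.re
  have hval : ∫ V, (Uᴴ * (V * U * Vᴴ)).trace ∂μ =
      (Fintype.card n : ℂ)⁻¹ * (U.trace * star U.trace) := by
    have hmap := h.map_twirl (traceLinearMap n ℂ ℂ ∘ₗ LinearMap.mulLeft ℂ Uᴴ) U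
    simp only [LinearMap.comp_apply, LinearMap.mulLeft_apply, traceLinearMap_apply] at hmap
    rw [← hmap, eq_inv_mul_iff_mul_eq₀ hcard, ← smul_eq_mul, ← trace_smul,
      ← mul_smul_comm, h.twirl_top, mul_smul_comm, mul_one, trace_smul, trace_conjTranspose, smul_eq_mul]
  have hre : ∫ V, (Uᴴ * (V * U * Vᴴ)).trace.re ∂μ =
      (Fintype.card n : ℝ)⁻¹ * (U.trace * star U.trace).re := by
    refine (integral_re hint).trans ?_
    rw [hval, ← Complex.ofReal_natCast, ← Complex.ofReal_inv]
    exact Complex.re_ofReal_mul _ _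
  trans ∫ V, (2 * (Fintype.card n : ℝ) - 2 * (Uᴴ * (V * U * Vᴴ)).trace.re) ∂μ
  · refine integral_congr_ae ?_
    filter_upwards [h.ae_mem] with V hV using hs2_commutator hU hV.2
  · rw [integral_sub (integrable_const _) (hint_re.const_mul 2), integral_const_mul,
    integral_const_mul, hre]
    simp [div_eq_mul_inv, mul_assoc]

end

/-- `S(A : M_d(ℂ)) = 1 - dim A'/d²`. -/
theorem stmt_7 (d : ℕ) (hd : 0 < d)
    (A : StarSubalgebra ℂ (Matrix (Fin d) (Fin d) ℂ))
    (μ ν : Measure (Matrix (Fin d) (Fin d) ℂ))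
    (hμ : IsHaar A μ) (hν : IsHaar (⊤ : StarSubalgebra ℂ (Matrix (Fin d) (Fin d) ℂ)) ν) :
    MAN μ ν = 1 - (Module.finrank ℂ ↥(commSub A) : ℝ) / (d : ℝ) ^ 2 := by
  have : Nonempty (Fin d) := ⟨⟨0, hd⟩⟩
  have := hμ.1
  have hd' : (d : ℝ) ≠ 0 := Nat.cast_ne_zero.2 hd.ne'
  have hint := hμ.integrable_trace_mul_star_trace
  have hint_re : Integrable (fun U => (U.trace * star U.trace).re) μ := hint.re
  have hre : ∫ U, (U.trace * star U.trace).re ∂μ = (Module.finrank ℂ (commSub A) : ℝ) := by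
    refine (integral_re hint).trans ?_
    rw [hμ.integral_trace_mul_star_trace]
    exact Complex.natCast_re _
  have hkey : ∫ U, ∫ V, hs2 (U * V - V * U) ∂ν ∂μ =
      ∫ U, (2 * (d : ℝ) - 2 / d * (U.trace * star U.trace).re) ∂μ := by
    refine integral_congr_ae ?_
    filter_upwards [hμ.ae_mem] with U hU
    simpa using hν.integral_hs2_commutator hU.2
  rw [MAN, hkey, integral_sub (integrable_const _) (hint_re.const_mul _), integral_const_mul,
    integral_const_mul, hre]
  simp only [integral_const, probReal_univ, one_smul, Fintype.card_fin]
  field_simp
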